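/- Let q₁, q₂ ∈ ℂ and q = q₁ + q₂·j. Suppose D_q is not the zero polynomial and that A_q(v) ≠ 0 for every complex root v of D_q. Then the preimage sets P⁻¹(q) ⊆ ℍ∖ℝ, (P∨)⁻¹(q) ⊆ ℍ∖ℝ and P_ℝ⁻¹(q) ⊆ 𝕊×ℝ are finite, and the sum of their cardinalities equals the number of distinct complex roots of D_q. In particular, if D_q has d = deg D_q distinct roots, then #P⁻¹(q) + #(P∨)⁻¹(q) + #P_ℝ⁻¹(q) = d. -/

import Mathlib

/-- The quaternion imaginary unit `i`. -/
noncomputable def qi : Quaternion ℝ := ⟨0, 1, 0, 0⟩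

/-- The quaternion imaginary unit `j`. -/
noncomputable def qj : Quaternion ℝ := ⟨0, 0, 1, 0⟩

/-- Identification of ℂ with the slice ℂ_i of the quaternions. -/
noncomputable def cq (z : ℂ) : Quaternion ℝ := ⟨z.re, z.im, 0, 0⟩

/-- The slice-polynomial function associated with `g, h, g', h'` at `α + βI` (`β > 0`). -/
noncomputable def Pslice (g h g' h' : Polynomial ℂ) (α β : ℝ) (I : Quaternion ℝ) : Quaternion ℝ :=
  ((1 - I * qi) / 2) * (cq (g.eval ⟨α, β⟩) + cq (h.eval ⟨α, β⟩) * qj) +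
  ((1 + I * qi) / 2) *
    (cq ((starRingEnd ℂ) (g'.eval ⟨α, β⟩)) + cq ((starRingEnd ℂ) (h'.eval ⟨α, β⟩)) * qj)

/-- The companion slice-polynomial function at `α + βI` (`β > 0`), using `v̄ = α - iβ`. -/
noncomputable def Pveeslice (g h g' h' : Polynomial ℂ) (α β : ℝ) (I : Quaternion ℝ) :
    Quaternion ℝ :=
  ((1 - I * qi) / 2) *
    (cq ((starRingEnd ℂ) (g'.eval ⟨α, -β⟩)) + cq ((starRingEnd ℂ) (h'.eval ⟨α, -β⟩)) * qj) +
  ((1 + I * qi) / 2) * (cq (g.eval ⟨α, -β⟩) + cq (h.eval ⟨α, -β⟩) * qj)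

/-- The extension to the real line of the slice-polynomial function. -/
noncomputable def PRext (g h g' h' : Polynomial ℂ) (I : Quaternion ℝ) (α : ℝ) : Quaternion ℝ :=
  ((1 - I * qi) / 2) * (cq (g.eval (α : ℂ)) + cq (h.eval (α : ℂ)) * qj) +
  ((1 + I * qi) / 2) *
    (cq ((starRingEnd ℂ) (g'.eval (α : ℂ))) + cq ((starRingEnd ℂ) (h'.eval (α : ℂ))) * qj)

/-- The slice-polynomial function as a function on `ℍ∖ℝ`: a nonreal quaternion `x` is
written as `α + βI` with `α = Re x`, `β = ‖Im x‖ > 0` and `I = Im x / ‖Im x‖ ∈ 𝕊`. -/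
noncomputable def Pfun (g h g' h' : Polynomial ℂ) (x : Quaternion ℝ) : Quaternion ℝ :=
  Pslice g h g' h' x.re ‖x.im‖ (‖x.im‖⁻¹ • x.im)

/-- The companion as a function on `ℍ∖ℝ`. -/
noncomputable def Pveefun (g h g' h' : Polynomial ℂ) (x : Quaternion ℝ) : Quaternion ℝ :=
  Pveeslice g h g' h' x.re ‖x.im‖ (‖x.im‖⁻¹ • x.im)

open Quaternion in
theorem quaternion_mul_self_eq_neg_one_iff (I : Quaternion ℝ) :
    I * I = -1 ↔ I.re = 0 ∧ normSq I = 1 := by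
  constructor
  · intro hI
    have hsq : normSq I * normSq I = 1 := by
      rw [← map_mul, hI, normSq_neg, map_one]
    have hnorm : normSq I = 1 := by
      nlinarith [normSq_nonneg (a := I)]
    have hne : I ≠ 0 := by
      rintro rfl
      simp at hnorm
    have hstar : I * star I = 1 := by
      rw [self_mul_star, hnorm, coe_one]
    have hneg : star I = -I := by
      apply mul_left_cancel₀ hne
      rw [hstar, mul_neg, hI, neg_neg]
    have hre := congrArg QuaternionAlgebra.re hneg
    simp only [re_star, re_neg] at hre
    exact ⟨by linarith, hnorm⟩
  · rintro ⟨hre, hnorm⟩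
    have hneg : star I = -I := by
      ext <;> simp [hre]
    have hmul : I * star I = 1 := by
      rw [self_mul_star, hnorm, coe_one]
    rw [hneg, mul_neg] at hmul
    rw [← hmul, neg_neg]

@[simp] theorem qi_re : qi.re = 0 := rfl

@[simp] theorem qi_imI : qi.imI = 1 := rfl

@[simp] theorem qi_imJ : qi.imJ = 0 := rfl

@[simp] theorem qi_imK : qi.imK = 0 := rfl

@[simp] theorem qj_re : qj.re = 0 := rfl

@[simp] theorem qj_imI : qj.imI = 0 := rfl

@[simp] theorem qj_imJ : qj.imJ = 1 := rfl

@[simp] theorem qj_imK : qj.imK = 0 := rfl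

@[simp] theorem cq_re (z : ℂ) : (cq z).re = z.re := rfl

@[simp] theorem cq_imI (z : ℂ) : (cq z).imI = z.im := rfl

@[simp] theorem cq_imJ (z : ℂ) : (cq z).imJ = 0 := rfl

@[simp] theorem cq_imK (z : ℂ) : (cq z).imK = 0 := rfl

theorem quaternion_two_ne_zero : (2 : Quaternion ℝ) ≠ 0 := by
  have h : ((2 : ℝ) : Quaternion ℝ) ≠ ((0 : ℝ) : Quaternion ℝ) :=
    Quaternion.coe_injective.ne two_ne_zero
  exact_mod_cast h

theorem qi_mul_qi : qi * qi = -1 := by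
  rw [quaternion_mul_self_eq_neg_one_iff]
  simp [Quaternion.normSq_def']

/-- The slice combination of `G` and `B` along `I` takes the value `q` precisely when
`I` solves a linear equation in the differences `G - q` and `B - q`. -/
theorem slice_combination_eq_iff (I G B q : Quaternion ℝ) :
    ((1 - I * qi) / 2) * G + ((1 + I * qi) / 2) * B = q ↔
      I * (qi * ((G - q) - (B - q))) = (G - q) + (B - q) := by
  have half (x : Quaternion ℝ) : x / 2 = (2⁻¹ : ℝ) • x := by
    rw [div_eq_iff quaternion_two_ne_zero, mul_two, ← two_smul ℝ, smul_smul]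
    norm_num
  have expand : ((1 - I * qi) / 2) * G + ((1 + I * qi) / 2) * B - q =
      (2⁻¹ : ℝ) • (((G - q) + (B - q)) - I * (qi * ((G - q) - (B - q)))) := by
    have hq : q = (2⁻¹ : ℝ) • (q + q) := by
      rw [← two_smul ℝ, smul_smul]
      norm_num
    rw [half, half, smul_mul_assoc, smul_mul_assoc, ← smul_add]
    nth_rewrite 1 [hq]
    rw [← smul_sub]
    congr 1
    noncomm_ring
  rw [← sub_eq_zero, expand, smul_eq_zero_iff_right (by norm_num), sub_eq_zero, eq_comm]

open Quaternion in
/-- For `G ≠ B`, the equation `I i (G - B) = G + B` has a solution in the sphere of imaginary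
units iff the `ℂ`-component of `B * star G` vanishes, and the solution is then explicit. -/
theorem imaginary_unit_solution_iff {G B : Quaternion ℝ} (hne : G ≠ B) (I : Quaternion ℝ) :
    (I * I = -1 ∧ I * (qi * (G - B)) = G + B) ↔
      ((B * star G).re = 0 ∧ (B * star G).imI = 0) ∧
        I = (G + B) * (G - B)⁻¹ * -qi := by
  have hsub : G - B ≠ 0 := sub_ne_zero.mpr hne
  have hN : normSq (G - B) ≠ 0 := normSq_ne_zero.mpr hsub
  have hsolve : I * (qi * (G - B)) = G + B ↔ I = (G + B) * (G - B)⁻¹ * -qi := by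
    rw [← mul_assoc, ← eq_mul_inv_iff_mul_eq₀ hsub]
    constructor
    · intro h
      rw [← h, mul_assoc, mul_neg, qi_mul_qi, neg_neg, mul_one]
    · rintro rfl
      rw [mul_assoc _ (-qi) qi, neg_mul, qi_mul_qi, neg_neg, mul_one]
  rw [hsolve]
  refine and_congr_left fun hI => ?_
  have hqi : normSq qi = 1 := by
    simp [normSq_def']
  have hnorm : normSq I = normSq (G + B) / normSq (G - B) := by
    rw [hI, map_mul, map_mul, normSq_neg, hqi, normSq_inv, mul_one, div_eq_mul_inv]
  have hre : I.re = (normSq (G - B))⁻¹ * (2 * (B * star G).imI) := by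
    rw [hI, Quaternion.inv_def, mul_smul_comm, smul_mul_assoc, re_smul, smul_eq_mul]
    congr 1
    simp
    ring
  have hdiff : normSq (G + B) - normSq (G - B) = 4 * (B * star G).re := by
    simp [normSq_def']
    ring
  rw [quaternion_mul_self_eq_neg_one_iff, hnorm, hre, div_eq_one_iff_eq hN,
    ← sub_eq_zero (a := normSq (G + B)), hdiff]
  simp [hN, and_comm]

/-- The slice polynomial with datum `v` takes the value `q₁ + q₂ j` at the imaginary unit `I`. -/
def SliceValueEq (g h g' h' : Polynomial ℂ) (q₁ q₂ v : ℂ) (I : Quaternion ℝ) : Prop :=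
  ((1 - I * qi) / 2) * (cq (g.eval v) + cq (h.eval v) * qj) +
    ((1 + I * qi) / 2) *
      (cq ((starRingEnd ℂ) (g'.eval v)) + cq ((starRingEnd ℂ) (h'.eval v)) * qj) =
    cq q₁ + cq q₂ * qj

open Quaternion in
theorem pairing_eq_zero_iff (a b c d q₁ q₂ : ℂ) (G B : Quaternion ℝ)
    (hG : G = (cq a + cq b * qj) - (cq q₁ + cq q₂ * qj))
    (hB : B = (cq ((starRingEnd ℂ) c) + cq ((starRingEnd ℂ) d) * qj) - (cq q₁ + cq q₂ * qj)) :
    ((B * star G).re = 0 ∧ (B * star G).imI = 0) ↔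
      -((a - q₁) * ((starRingEnd ℂ) q₁ - c)) + (b - q₂) * (d - (starRingEnd ℂ) q₂) = 0 := by
  subst hG hB
  rw [Complex.ext_iff]
  refine and_congr ?_ ?_
  · simp
    constructor <;> intro h <;> linarith
  · simp
    constructor <;> intro h <;> linarith

open Quaternion in
/-- Outside the zeros of the matrix `A_q`, the imaginary units solving the slice equation at `v`
are unique, and exist exactly when `D_q(v) = 0`. -/
theorem sliceValueEq_solutions (g h g' h' : Polynomial ℂ) (q₁ q₂ v : ℂ)
    (hA : -((g.eval v - q₁) * ((starRingEnd ℂ) q₁ - g'.eval v)) +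
        (h.eval v - q₂) * (h'.eval v - (starRingEnd ℂ) q₂) = 0 →
      ¬(g.eval v - q₁ = 0 ∧ -h'.eval v + (starRingEnd ℂ) q₂ = 0 ∧
          h.eval v - q₂ = 0 ∧ -(starRingEnd ℂ) q₁ + g'.eval v = 0)) :
    ((∃ I, I * I = -1 ∧ SliceValueEq g h g' h' q₁ q₂ v I) ↔
      -((g.eval v - q₁) * ((starRingEnd ℂ) q₁ - g'.eval v)) +
        (h.eval v - q₂) * (h'.eval v - (starRingEnd ℂ) q₂) = 0) ∧
    ∀ I J, I * I = -1 → SliceValueEq g h g' h' q₁ q₂ v I →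
      J * J = -1 → SliceValueEq g h g' h' q₁ q₂ v J → I = J := by
  simp only [SliceValueEq, slice_combination_eq_iff]
  obtain ⟨G, hG⟩ : ∃ G, G = (cq (g.eval v) + cq (h.eval v) * qj) - (cq q₁ + cq q₂ * qj) :=
    ⟨_, rfl⟩
  obtain ⟨B, hB⟩ : ∃ B, B = (cq ((starRingEnd ℂ) (g'.eval v)) +
      cq ((starRingEnd ℂ) (h'.eval v)) * qj) - (cq q₁ + cq q₂ * qj) := ⟨_, rfl⟩
  have hpair := pairing_eq_zero_iff _ _ _ _ q₁ q₂ G B hG hB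
  rw [← hG, ← hB, ← hpair]
  rw [← hpair] at hA
  have hzero : ¬(G = 0 ∧ B = 0) := by
    rintro ⟨hG0, hB0⟩
    refine hA (by simp [hG0]) ?_
    rw [hG, sub_eq_zero, Quaternion.ext_iff] at hG0
    rw [hB, sub_eq_zero, Quaternion.ext_iff] at hB0
    obtain ⟨h₁, h₂, h₃, h₄⟩ := hG0
    obtain ⟨k₁, k₂, k₃, k₄⟩ := hB0
    simp at h₁ h₂ h₃ h₄ k₁ k₂ k₃ k₄
    refine ⟨?_, ?_, ?_, ?_⟩ <;> apply Complex.ext <;> simp <;> linarith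
  by_cases hne : G = B
  · subst hne
    have hG0 : G ≠ 0 := fun h0 => hzero ⟨h0, h0⟩
    have hno (I : Quaternion ℝ) : ¬I * (qi * (G - G)) = G + G := by
      rw [sub_self, mul_zero, mul_zero, ← two_mul, eq_comm]
      exact mul_ne_zero quaternion_two_ne_zero hG0
    refine ⟨⟨fun ⟨I, _, h⟩ => (hno I h).elim, fun h => ?_⟩, fun I J _ h => (hno I h).elim⟩
    rw [self_mul_star, re_coe] at h
    exact (hG0 (normSq_eq_zero.mp h.1)).elim
  · refine ⟨?_, fun I J hI hI' hJ hJ' => ?_⟩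
    · simp only [imaginary_unit_solution_iff hne]
      exact ⟨fun ⟨_, h, _⟩ => h, fun h => ⟨_, h, rfl⟩⟩
    · rw [((imaginary_unit_solution_iff hne I).mp ⟨hI, hI'⟩).2,
        ((imaginary_unit_solution_iff hne J).mp ⟨hJ, hJ'⟩).2]

open Quaternion in
theorem normalized_im_mul_self {x : Quaternion ℝ} (hx : x.im ≠ 0) :
    (‖x.im‖⁻¹ • x.im) * (‖x.im‖⁻¹ • x.im) = -1 := by
  have hn : ‖x.im‖ ≠ 0 := norm_ne_zero_iff.mpr hx
  rw [quaternion_mul_self_eq_neg_one_iff]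
  refine ⟨by simp, ?_⟩
  rw [normSq_smul, normSq_eq_norm_mul_self]
  field_simp

open Quaternion in
/-- The map `α + βI ↦ α + iβ` from nonreal quaternions to the upper half-plane restricts to a
bijection from the zero set of a condition with unique slice solutions onto its projection. -/
theorem bijOn_upper_half_plane (T : ℂ → Quaternion ℝ → Prop)
    (huniq : ∀ v I J, I * I = -1 → T v I → J * J = -1 → T v J → I = J) :
    Set.BijOn (fun x : Quaternion ℝ => (⟨x.re, ‖x.im‖⟩ : ℂ))
      {x | x.im ≠ 0 ∧ T ⟨x.re, ‖x.im‖⟩ (‖x.im‖⁻¹ • x.im)}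
      {v | 0 < v.im ∧ ∃ I, I * I = -1 ∧ T v I} := by
  refine ⟨?_, ?_, ?_⟩
  · rintro x ⟨hx, hT⟩
    exact ⟨norm_pos_iff.mpr hx, _, normalized_im_mul_self hx, hT⟩
  · rintro x ⟨hx, hxT⟩ y ⟨hy, hyT⟩ hxy
    simp only [Complex.mk.injEq] at hxy
    obtain ⟨hre, hnorm⟩ := hxy
    rw [← hre, ← hnorm] at hyT
    have hy' := normalized_im_mul_self hy
    rw [← hnorm] at hy'
    have hI := huniq _ _ _ (normalized_im_mul_self hx) hxT hy' hyT
    have him : x.im = y.im :=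
      smul_right_injective _ (inv_ne_zero (norm_ne_zero_iff.mpr hx)) hI
    rw [← re_add_im x, ← re_add_im y, hre, him]
  · rintro v ⟨hv, I, hI, hT⟩
    obtain ⟨hre, hnormSq⟩ := (quaternion_mul_self_eq_neg_one_iff I).mp hI
    have hnorm : ‖I‖ = 1 := by
      rw [normSq_eq_norm_mul_self] at hnormSq
      nlinarith [norm_nonneg I]
    have him : ((v.re : Quaternion ℝ) + v.im • I).im = v.im • I := by
      ext <;> simp [hre]
    have hxre : ((v.re : Quaternion ℝ) + v.im • I).re = v.re := by
      simp [hre]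
    have hxnorm : ‖((v.re : Quaternion ℝ) + v.im • I).im‖ = v.im := by
      rw [him, norm_smul, hnorm, mul_one, Real.norm_of_nonneg hv.le]
    refine ⟨(v.re : Quaternion ℝ) + v.im • I, ⟨?_, ?_⟩, ?_⟩
    · rw [← norm_ne_zero_iff, hxnorm]
      exact hv.ne'
    · rw [hxnorm, hxre, him, smul_smul, inv_mul_cancel₀ hv.ne', one_smul]
      exact hT
    · simp only [hxnorm, hxre]

theorem card_eq_card_im_pos_add_card_im_neg_add_card_im_zero (s : Finset ℂ) :
    {v | 0 < v.im ∧ v ∈ s}.ncard + {v | v.im < 0 ∧ v ∈ s}.ncard +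
      {v | v.im = 0 ∧ v ∈ s}.ncard = s.card := by
  classical
  have hcoe (p : ℂ → Prop) : {v | p v ∧ v ∈ s}.ncard = (s.filter p).card := by
    rw [← Set.ncard_coe_finset]
    congr 1
    ext v
    simp [and_comm]
  rw [hcoe (fun v => 0 < v.im), hcoe (fun v => v.im < 0), hcoe (fun v => v.im = 0),
    ← Finset.card_union_of_disjoint, ← Finset.card_union_of_disjoint]
  · congr 1
    ext v
    simp only [Finset.mem_union, Finset.mem_filter]
    rcases lt_trichotomy v.im 0 with h | h | h <;> simp [h] <;> tauto
  · rw [Finset.disjoint_left]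
    intro v
    simp only [Finset.mem_union, Finset.mem_filter]
    rintro (h | h) h'
    · exact h.2.ne' h'.2
    · exact h.2.ne h'.2
  · rw [Finset.disjoint_left]
    intro v
    simp only [Finset.mem_filter]
    exact fun h h' => lt_asymm h.2 h'.2

/-- Counting of the simultaneous preimages of `q = q₁ + q₂ j` via `P`, `P∨` and `P_ℝ`:
if `D_q ≠ 0` and the matrix `A_q` does not vanish at any root of `D_q`, then the preimages
are finite and their total number is the number of distinct roots of `D_q`. -/
theorem card_preimages_eq_card_roots (g h g' h' : Polynomial ℂ) (q₁ q₂ : ℂ)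
    (Dq : Polynomial ℂ)
    (hDq : Dq = -((g - Polynomial.C q₁) * (Polynomial.C ((starRingEnd ℂ) q₁) - g')) +
      (h - Polynomial.C q₂) * (h' - Polynomial.C ((starRingEnd ℂ) q₂)))
    (hD0 : Dq ≠ 0)
    (hA : ∀ v : ℂ, Dq.eval v = 0 →
      ¬(g.eval v - q₁ = 0 ∧ -h'.eval v + (starRingEnd ℂ) q₂ = 0 ∧
          h.eval v - q₂ = 0 ∧ -(starRingEnd ℂ) q₁ + g'.eval v = 0)) :
    ({x : Quaternion ℝ | x.im ≠ 0 ∧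
        Pfun g h g' h' x = cq q₁ + cq q₂ * qj}).Finite ∧
    ({x : Quaternion ℝ | x.im ≠ 0 ∧
        Pveefun g h g' h' x = cq q₁ + cq q₂ * qj}).Finite ∧
    ({p : Quaternion ℝ × ℝ | p.1 * p.1 = -1 ∧
        PRext g h g' h' p.1 p.2 = cq q₁ + cq q₂ * qj}).Finite ∧
    ({x : Quaternion ℝ | x.im ≠ 0 ∧
        Pfun g h g' h' x = cq q₁ + cq q₂ * qj}).ncard +
      ({x : Quaternion ℝ | x.im ≠ 0 ∧
        Pveefun g h g' h' x = cq q₁ + cq q₂ * qj}).ncard +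
      ({p : Quaternion ℝ × ℝ | p.1 * p.1 = -1 ∧
        PRext g h g' h' p.1 p.2 = cq q₁ + cq q₂ * qj}).ncard =
      Dq.roots.toFinset.card := by
  have heval (v : ℂ) : Dq.eval v =
      -((g.eval v - q₁) * ((starRingEnd ℂ) q₁ - g'.eval v)) +
        (h.eval v - q₂) * (h'.eval v - (starRingEnd ℂ) q₂) := by
    rw [hDq]
    simp
  have hsol (v : ℂ) := sliceValueEq_solutions g h g' h' q₁ q₂ v (heval v ▸ hA v)
  have hroot (v : ℂ) : (∃ I, I * I = -1 ∧ SliceValueEq g h g' h' q₁ q₂ v I) ↔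
      v ∈ Dq.roots.toFinset := by
    rw [(hsol v).1, ← heval, Multiset.mem_toFinset, Polynomial.mem_roots hD0, Polynomial.IsRoot]
  have hupper := bijOn_upper_half_plane (SliceValueEq g h g' h' q₁ q₂) fun v => (hsol v).2
  have hlower := bijOn_upper_half_plane
    (fun v I => SliceValueEq g h g' h' q₁ q₂ ((starRingEnd ℂ) v) (-I))
    fun v I J hI hTI hJ hTJ =>
      neg_injective ((hsol _).2 (-I) (-J) (by rwa [neg_mul_neg]) hTI (by rwa [neg_mul_neg]) hTJ)
  have hconj : Set.BijOn (starRingEnd ℂ)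
      {v | 0 < v.im ∧ ∃ I, I * I = -1 ∧
        SliceValueEq g h g' h' q₁ q₂ ((starRingEnd ℂ) v) (-I)}
      {v | v.im < 0 ∧ v ∈ Dq.roots.toFinset} := by
    refine ⟨?_, (starRingEnd ℂ).injective.injOn, ?_⟩
    · rintro v ⟨hv, I, hI, hT⟩
      exact ⟨by simpa using hv, (hroot _).mp ⟨-I, by rwa [neg_mul_neg], hT⟩⟩
    · rintro v ⟨hv, hv'⟩
      obtain ⟨I, hI, hT⟩ := (hroot v).mpr hv'
      refine ⟨(starRingEnd ℂ) v, ⟨by simpa using hv, -I, by rwa [neg_mul_neg], ?_⟩, by simp⟩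
      rwa [Complex.conj_conj, neg_neg]
  have hreal : Set.BijOn (fun p : Quaternion ℝ × ℝ => (p.2 : ℂ))
      {p | p.1 * p.1 = -1 ∧ PRext g h g' h' p.1 p.2 = cq q₁ + cq q₂ * qj}
      {v | v.im = 0 ∧ v ∈ Dq.roots.toFinset} := by
    refine ⟨?_, ?_, ?_⟩
    · rintro ⟨I, α⟩ ⟨hI, hT⟩
      exact ⟨Complex.ofReal_im α, (hroot _).mp ⟨I, hI, hT⟩⟩
    · rintro ⟨I, α⟩ ⟨hI, hTI⟩ ⟨J, γ⟩ ⟨hJ, hTJ⟩ hαγ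
      obtain rfl : α = γ := Complex.ofReal_injective hαγ
      exact Prod.ext ((hsol α).2 I J hI hTI hJ hTJ) rfl
    · rintro v ⟨hv, hv'⟩
      obtain ⟨I, hI, hT⟩ := (hroot v).mpr hv'
      obtain ⟨α, rfl⟩ : ∃ α : ℝ, (α : ℂ) = v := ⟨v.re, Complex.ext rfl hv.symm⟩
      exact ⟨(I, α), ⟨hI, hT⟩, rfl⟩
  simp only [hroot] at hupper
  have hvee := hconj.comp hlower
  have hveeSet : {x : Quaternion ℝ | x.im ≠ 0 ∧
      Pveefun g h g' h' x = cq q₁ + cq q₂ * qj} =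
      {x | x.im ≠ 0 ∧ SliceValueEq g h g' h' q₁ q₂
        ((starRingEnd ℂ) ⟨x.re, ‖x.im‖⟩) (-(‖x.im‖⁻¹ • x.im))} := by
    ext x
    simp only [Set.mem_ofPred_eq, Pveefun, Pveeslice, SliceValueEq, neg_mul, sub_neg_eq_add,
      ← sub_eq_add_neg]
    rw [add_comm (_ * _) (_ * _)]
    rfl
  rw [← hveeSet] at hvee
  have hfinite (p : ℂ → Prop) : {v | p v ∧ v ∈ Dq.roots.toFinset}.Finite :=
    Dq.roots.toFinset.finite_toSet.subset fun v hv => hv.2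
  refine ⟨hupper.finite_iff_finite.mpr (hfinite _), hvee.finite_iff_finite.mpr (hfinite _),
    hreal.finite_iff_finite.mpr (hfinite _), ?_⟩
  rw [← card_eq_card_im_pos_add_card_im_neg_add_card_im_zero]
  exact congrArg₂ _ (congrArg₂ _ hupper.ncard_eq hvee.ncard_eq) hreal.ncard_eq
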